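/- arXiv:2206.00492 — 3 statements merged into one kernel-verified Lean document; each statement's English description precedes it below -/
import Mathlib

section
/- Let n ≥ 2, 0 < p < n, a = 2/(n+p), b = (n+p-2)/(n+p), and Ω = {(x', x_n) : |x'| < 1, 0 < x_n < 1 - |x'|²}. Then the function w(x', x_n) = x_n - x_n^a (1 - |x'|²)^b satisfies ∫_Ω det D²w dx < ∞, i.e., det D²w ∈ L¹(Ω). -/
open Real

/-- The Hessian determinant of a function on Euclidean space, computed via
iterated Fréchet derivatives in the standard coordinate directions. -/
noncomputable def hessDet {n : ℕ} (w : EuclideanSpace ℝ (Fin n) → ℝ)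
    (x : EuclideanSpace ℝ (Fin n)) : ℝ :=
  (Matrix.of fun i j : Fin n =>
    fderiv ℝ (fun y => fderiv ℝ w y (EuclideanSpace.single i 1)) x
      (EuclideanSpace.single j 1)).det

open MeasureTheory Set

lemma aux_inner (r : ℝ) (hr : -1 < r) (g : ℝ) (hg : 0 < g) :
    ∫⁻ t in Ioo 0 g, ENNReal.ofReal (t ^ r * g ^ (-(r+1))) = ENNReal.ofReal (1 / (r+1)) := by
  have hi : IntegrableOn (fun t : ℝ => t ^ r * g ^ (-(r+1))) (Ioo 0 g) := by
    have h := (intervalIntegral.intervalIntegrable_rpow' (a := 0) (b := g) hr)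
    rw [intervalIntegrable_iff_integrableOn_Ioo_of_le hg.le] at h
    exact h.mul_const _
  rw [← ofReal_integral_eq_lintegral_ofReal hi]
  · congr 1
    rw [← integral_Ioc_eq_integral_Ioo, ← intervalIntegral.integral_of_le hg.le,
      intervalIntegral.integral_mul_const, integral_rpow (Or.inl hr),
      Real.zero_rpow (by linarith), Real.rpow_neg hg.le]
    have : g ^ (r+1) ≠ 0 := (Real.rpow_pos_of_pos hg _).ne'
    have : r + 1 ≠ 0 := by linarith
    field_simp
    ring
  · refine (ae_restrict_iff' measurableSet_Ioo).2 (Filter.Eventually.of_forall fun t ht => ?_)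
    have := ht.1
    simp only [Pi.zero_apply]
    positivity

lemma aux_prod (m : ℕ) (r : ℝ) (hr : -1 < r) :
    IntegrableOn (fun z : ℝ × (Fin m → ℝ) => z.1 ^ r * (1 - ∑ j, z.2 j ^ 2) ^ (-(r+1)))
      {z | ∑ j, z.2 j ^ 2 < 1 ∧ 0 < z.1 ∧ z.1 < 1 - ∑ j, z.2 j ^ 2} := by
  set S : Set (ℝ × (Fin m → ℝ)) :=
    {z | ∑ j, z.2 j ^ 2 < 1 ∧ 0 < z.1 ∧ z.1 < 1 - ∑ j, z.2 j ^ 2} with hS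
  have hSm : MeasurableSet S := by
    have a1 : MeasurableSet {z : ℝ × (Fin m → ℝ) | ∑ j, z.2 j ^ 2 < 1} :=
      measurableSet_lt (by fun_prop) (by fun_prop)
    have a2 : MeasurableSet {z : ℝ × (Fin m → ℝ) | 0 < z.1} :=
      measurableSet_lt (by fun_prop) (by fun_prop)
    have a3 : MeasurableSet {z : ℝ × (Fin m → ℝ) | z.1 < 1 - (∑ j, z.2 j ^ 2)} :=
      measurableSet_lt (by fun_prop) (by fun_prop)
    exact a1.inter (a2.inter a3)
  have hfm : Measurable (fun z : ℝ × (Fin m → ℝ) =>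
      z.1 ^ r * (1 - ∑ j, z.2 j ^ 2) ^ (-(r+1))) := by fun_prop
  refine ⟨hfm.aestronglyMeasurable, ?_⟩
  rw [hasFiniteIntegral_iff_ofReal]
  swap
  · refine (ae_restrict_iff' hSm).2 (Filter.Eventually.of_forall fun z hz => ?_)
    obtain ⟨h1, h2, h3⟩ := hz
    have : 0 < 1 - ∑ j, z.2 j ^ 2 := by linarith
    simp only [Pi.zero_apply]
    positivity
  rw [← lintegral_indicator hSm, Measure.volume_eq_prod,
    lintegral_prod_symm' _ ((hfm.ennreal_ofReal).indicator hSm)]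
  have key : ∀ y : Fin m → ℝ,
      ∫⁻ t : ℝ, S.indicator (fun z : ℝ × (Fin m → ℝ) => ENNReal.ofReal
        (z.1 ^ r * (1 - ∑ j, z.2 j ^ 2) ^ (-(r+1)))) (t, y) ≤
      (Icc (-1 : Fin m → ℝ) 1).indicator (fun _ => ENNReal.ofReal (1 / (r+1))) y := by
    intro y
    by_cases hy : ∑ j, y j ^ 2 < 1
    · have hyI : y ∈ Icc (-1 : Fin m → ℝ) 1 := by
        have : ∀ j, y j ^ 2 ≤ 1 := fun j =>
          (Finset.single_le_sum (f := fun j => y j ^ 2) (fun i _ => sq_nonneg _)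
            (Finset.mem_univ j)).trans hy.le
        exact ⟨fun j => (abs_le.1 ((sq_le_one_iff_abs_le_one _).1 (this j))).1,
          fun j => (abs_le.1 ((sq_le_one_iff_abs_le_one _).1 (this j))).2⟩
      rw [indicator_of_mem hyI, ← aux_inner r hr (1 - ∑ j, y j ^ 2) (by linarith),
        ← lintegral_indicator measurableSet_Ioo]
      refine lintegral_mono fun t => ?_
      by_cases ht : t ∈ Ioo 0 (1 - ∑ j, y j ^ 2)
      · rw [indicator_of_mem ht, indicator_of_mem (show (t, y) ∈ S from ⟨hy, ht⟩)]
      · rw [indicator_of_notMem (show (t, y) ∉ S from fun h => ht h.2)]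
        exact zero_le
    · have : ∀ t : ℝ, (t, y) ∉ S := fun t h => hy h.1
      simp [this]
  refine (lintegral_mono key).trans_lt ?_
  rw [lintegral_indicator measurableSet_Icc, setLIntegral_const]
  exact ENNReal.mul_lt_top ENNReal.ofReal_lt_top (isCompact_Icc.measure_lt_top)

lemma aux_euc (m : ℕ) (r : ℝ) (hr : -1 < r) (i0 : Fin (m+1)) :
    IntegrableOn (fun x : EuclideanSpace ℝ (Fin (m+1)) =>
        x i0 ^ r * (1 - (‖x‖ ^ 2 - x i0 ^ 2)) ^ (-(r+1)))
      {x | ‖x‖ ^ 2 - x i0 ^ 2 < 1 ∧ 0 < x i0 ∧ x i0 < 1 - (‖x‖ ^ 2 - x i0 ^ 2)} := by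
  have e1 := EuclideanSpace.volume_preserving_symm_measurableEquiv_toLp (Fin (m+1))
  have e2 := volume_preserving_piFinSuccAbove (fun _ : Fin (m+1) => ℝ) i0
  have e := e2.comp e1
  have hemb : MeasurableEmbedding ((MeasurableEquiv.piFinSuccAbove (fun _ : Fin (m+1) => ℝ) i0) ∘
      ((MeasurableEquiv.toLp 2 (Fin (m+1) → ℝ)).symm)) :=
    (MeasurableEquiv.measurableEmbedding _).comp (MeasurableEquiv.measurableEmbedding _)
  have h := (e.integrableOn_comp_preimage hemb).2 (aux_prod m r hr)
  have hn : ∀ x : EuclideanSpace ℝ (Fin (m+1)), ‖x‖ ^ 2 - x i0 ^ 2 =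
      ∑ j, x (i0.succAbove j) ^ 2 := by
    intro x
    rw [EuclideanSpace.real_norm_sq_eq, Fin.sum_univ_succAbove _ i0]
    ring
  simp only [hn]
  exact h

lemma aux_det {n : ℕ} (i0 : Fin n) (c d : ℝ) (v : Fin n → ℝ) (hv : v i0 ≠ 0)
    (M : Matrix (Fin n) (Fin n) ℝ)
    (hM : ∀ i j, M i j = c * v i * v j + (if i = j then (if i = i0 then 0 else d) else 0)) :
    M.det = c * v i0 ^ 2 * d ^ (n - 1) := by
  classical
  set u : Fin n → ℝ := fun i => v i / v i0 - if i = i0 then 1 else 0 with hu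
  set L : Matrix (Fin n) (Fin n) ℝ := 1 + Matrix.vecMulVec u (Pi.single i0 1) with hL
  have hLd : L.det = 1 := by
    rw [hL, Matrix.vecMulVec_eq Unit, Matrix.det_one_add_replicateCol_mul_replicateRow]
    simp [hu, hv]
  set D : Fin n → ℝ := fun i => if i = i0 then c * v i0 ^ 2 else d with hD
  have hLa : ∀ i k, L i k = if k = i0 then v i / v i0 else if i = k then 1 else 0 := by
    intro i k
    simp only [hL, hu, Matrix.add_apply, Matrix.vecMulVec_apply, Matrix.one_apply, Pi.single_apply]
    by_cases hk : k = i0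
    · subst hk; simp
    · simp [hk]
  have hfac : M = L * Matrix.diagonal D * L.transpose := by
    ext i j
    rw [hM, Matrix.mul_apply]
    simp only [Matrix.mul_diagonal, Matrix.transpose_apply, hLa]
    rw [← Finset.add_sum_erase _ _ (Finset.mem_univ i0)]
    congr 1
    · simp [hD]; field_simp
    · rw [Finset.sum_congr rfl (g := fun k => if i = k then (if i = j then d else 0) else 0)]
      · rw [Finset.sum_ite_eq]
        by_cases h : i = i0 <;> simp [h]
      · intro k hk
        have hk' := Finset.ne_of_mem_erase hk
        simp only [hk', if_false, hD]
        by_cases h : i = k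
        · subst h; simp [eq_comm]
        · simp [h]
  rw [hfac, Matrix.det_mul, Matrix.det_mul, Matrix.det_transpose, hLd, Matrix.det_diagonal,
    ← Finset.mul_prod_erase _ _ (Finset.mem_univ i0)]
  rw [Finset.prod_congr rfl (g := fun _ => d)]
  · simp [hD]
  · intro k hk
    simp [hD, Finset.ne_of_mem_erase hk]

/-- derivative of the product of powers -/
lemma aux_deriv {n : ℕ} (i0 : Fin n) (α β : ℝ) (y : EuclideanSpace ℝ (Fin n))
    (ht : 0 < y i0) (hg : 0 < 1 - (‖y‖ ^ 2 - y i0 ^ 2)) :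
    ∃ L : EuclideanSpace ℝ (Fin n) →L[ℝ] ℝ,
      HasFDerivAt (fun y : EuclideanSpace ℝ (Fin n) =>
        y i0 ^ α * (1 - (‖y‖ ^ 2 - y i0 ^ 2)) ^ β) L y ∧
      ∀ j, L (EuclideanSpace.single j 1) =
        α * y i0 ^ (α - 1) * (1 - (‖y‖ ^ 2 - y i0 ^ 2)) ^ β * (if j = i0 then 1 else 0) -
        2 * β * y i0 ^ α * (1 - (‖y‖ ^ 2 - y i0 ^ 2)) ^ (β - 1) *
          (y j - y i0 * (if j = i0 then 1 else 0)) := by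
  have h1 : HasFDerivAt (fun y : EuclideanSpace ℝ (Fin n) => y i0)
    (EuclideanSpace.proj i0 : EuclideanSpace ℝ (Fin n) →L[ℝ] ℝ) y :=
    (EuclideanSpace.proj i0 : EuclideanSpace ℝ (Fin n) →L[ℝ] ℝ).hasFDerivAt
  have h2 : HasFDerivAt (fun y : EuclideanSpace ℝ (Fin n) => ‖y‖ ^ 2) (2 • innerSL ℝ y) y :=
    (hasStrictFDerivAt_norm_sq y).hasFDerivAt
  have h3 := ((h2.sub (h1.pow 2)).const_sub 1).rpow_const (p := β) (Or.inl hg.ne')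
  have h4 := h1.rpow_const (p := α) (Or.inl ht.ne')
  refine ⟨_, h4.mul h3, fun j => ?_⟩
  simp [EuclideanSpace.inner_single_right, eq_comm (a := i0)]
  split_ifs <;> ring

lemma aux_hess {n : ℕ} (i0 : Fin n) (a b : ℝ) (hab : a + b = 1)
    (w : EuclideanSpace ℝ (Fin n) → ℝ)
    (hw : ∀ x, w x = x i0 - (x i0) ^ a * (1 - (‖x‖ ^ 2 - x i0 ^ 2)) ^ b)
    (x : EuclideanSpace ℝ (Fin n))
    (ht : 0 < x i0) (hg : 0 < 1 - (‖x‖ ^ 2 - x i0 ^ 2)) :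
    hessDet w x = a * b * (2 * b) ^ (n - 1) * (x i0 ^ (n * a - 2) *
      (1 - (‖x‖ ^ 2 - x i0 ^ 2)) ^ (-((n * a - 2) + 1))) := by
  have hproj : ∀ (i : Fin n) (y : EuclideanSpace ℝ (Fin n)),
      HasFDerivAt (fun y : EuclideanSpace ℝ (Fin n) => y i)
      (EuclideanSpace.proj i : EuclideanSpace ℝ (Fin n) →L[ℝ] ℝ) y := fun i y =>
    (EuclideanSpace.proj i : EuclideanSpace ℝ (Fin n) →L[ℝ] ℝ).hasFDerivAt
  have hw' : w = fun x => x i0 - (x i0) ^ a * (1 - (‖x‖ ^ 2 - x i0 ^ 2)) ^ b := funext hw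
  have hfirst : ∀ y : EuclideanSpace ℝ (Fin n), 0 < y i0 → 0 < 1 - (‖y‖ ^ 2 - y i0 ^ 2) →
      ∀ i, fderiv ℝ w y (EuclideanSpace.single i 1) = (if i = i0 then 1 else 0) -
        (a * (if i = i0 then 1 else 0) * (y i0 ^ (a - 1) * (1 - (‖y‖ ^ 2 - y i0 ^ 2)) ^ b) -
        2 * b * (y i0 ^ a * (1 - (‖y‖ ^ 2 - y i0 ^ 2)) ^ (b - 1) *
          (y i - (if i = i0 then 1 else 0) * y i0))) := by
    intro y h1 h2 i
    obtain ⟨L, hL, hL'⟩ := aux_deriv i0 a b y h1 h2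
    have hd : HasFDerivAt w (EuclideanSpace.proj i0 - L) y := by
      rw [hw']; exact (hproj i0 y).sub hL
    rw [hd.fderiv]
    simp [hL', Pi.single_apply, eq_comm (a := i0)]
    split_ifs <;> ring
  have hopen : ∀ᶠ y in nhds x, 0 < y i0 ∧ 0 < 1 - (‖y‖ ^ 2 - y i0 ^ 2) := by
    have c1 : Continuous fun y : EuclideanSpace ℝ (Fin n) => y i0 := by fun_prop
    have c2 : Continuous fun y : EuclideanSpace ℝ (Fin n) => 1 - (‖y‖ ^ 2 - y i0 ^ 2) := by
      fun_prop
    exact (c1.continuousAt.eventually_const_lt ht).and (c2.continuousAt.eventually_const_lt hg)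
  set t := x i0 with htdef
  set g := 1 - (‖x‖ ^ 2 - t ^ 2) with hgdef
  have ht' := ht.ne'
  have hg' := hg.ne'
  have hsecond : ∀ i j, fderiv ℝ (fun y => fderiv ℝ w y (EuclideanSpace.single i 1)) x
      (EuclideanSpace.single j 1) =
      (a * b * (t ^ a * g ^ b)) *
        (if i = i0 then 1 / t else 2 * x i / g) * (if j = i0 then 1 / t else 2 * x j / g) +
        (if i = j then (if i = i0 then 0 else 2 * b * (t ^ a * g ^ (b - 1))) else 0) := by
    intro i j
    have hev : (fun y => fderiv ℝ w y (EuclideanSpace.single i 1)) =ᶠ[nhds x] _ :=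
      hopen.mono fun y hy => hfirst y hy.1 hy.2 i
    rw [hev.fderiv_eq]
    obtain ⟨L1, hL1, hL1'⟩ := aux_deriv i0 (a-1) b x ht hg
    obtain ⟨L2, hL2, hL2'⟩ := aux_deriv i0 a (b-1) x ht hg
    have hd := ((hL1.const_mul (a * (if i = i0 then 1 else 0))).sub
      ((hL2.mul ((hproj i x).sub ((hproj i0 x).const_mul (if i = i0 then 1 else 0)))).const_mul
        (2 * b))).const_sub (if i = i0 then (1:ℝ) else 0)
    erw [hd.fderiv]
    have ra1 : t ^ (a - 1) = t ^ a / t := by rw [Real.rpow_sub ht, Real.rpow_one]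
    have ra2 : t ^ (a - 1 - 1) = t ^ a / t / t := by rw [Real.rpow_sub ht, Real.rpow_one, ra1]
    have rb1 : g ^ (b - 1) = g ^ b / g := by rw [Real.rpow_sub hg, Real.rpow_one]
    have rb2 : g ^ (b - 1 - 1) = g ^ b / g / g := by rw [Real.rpow_sub hg, Real.rpow_one, rb1]
    have hb : b = 1 - a := by linarith
    simp only [neg_apply, sub_apply, add_apply, smul_apply,
      FunLike.coe_smul, Pi.smul_apply, FunLike.coe_sub, Pi.sub_apply, FunLike.coe_add, Pi.add_apply,
      hL1', hL2', smul_eq_mul, ← htdef, ← hgdef, ra1, ra2, rb1, rb2, PiLp.proj_apply,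
      PiLp.single_apply, FunLike.coe_neg, Pi.neg_apply]
    generalize t ^ a = A
    generalize g ^ b = B
    subst hb
    by_cases hi : i = i0
    · by_cases hj : j = i0
      · subst hi; subst hj
        simp [← htdef]
        field_simp
        ring
      · have : i ≠ j := fun h => hj (h ▸ hi)
        subst hi
        simp [hj, this, Ne.symm hj, ← htdef]
        field_simp
        try ring
    · by_cases hj : j = i0
      · subst hj
        simp [hi, ← htdef]
        field_simp
        try ring
      · by_cases hij : i = j
        · subst hij
          simp [hi, Ne.symm hi]
          field_simp
          try ring
        · simp [hi, hj, hij, Ne.symm hi, Ne.symm hj]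
          field_simp
          try ring
  rw [hessDet, aux_det i0 (a * b * (t ^ a * g ^ b)) (2 * b * (t ^ a * g ^ (b - 1)))
    (fun i => if i = i0 then 1 / t else 2 * x i / g) (by simp [ht'])
    (Matrix.of fun i j : Fin n =>
    fderiv ℝ (fun y => fderiv ℝ w y (EuclideanSpace.single i 1)) x
      (EuclideanSpace.single j 1)) (fun i j => hsecond i j)]
  have hn : 1 ≤ n := i0.pos
  have hcast : ((n - 1 : ℕ) : ℝ) = n - 1 := by push_cast [hn]; ring
  simp only [if_true]
  rw [mul_pow, mul_pow, mul_pow, ← Real.rpow_mul_natCast ht.le, ← Real.rpow_mul_natCast hg.le, hcast]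
  have e1 : t ^ ((n:ℝ) * a - 2) = t ^ a * (1 / t) ^ 2 * t ^ (a * ((n:ℝ) - 1)) := by
    rw [show (n:ℝ) * a - 2 = a + a * ((n:ℝ) - 1) - (2:ℕ) by push_cast; ring,
      Real.rpow_sub ht, Real.rpow_add ht, Real.rpow_natCast]
    field_simp
  have e2 : g ^ (-((n:ℝ) * a - 2 + 1)) = g ^ b * g ^ ((b - 1) * ((n:ℝ) - 1)) := by
    rw [← Real.rpow_add hg]
    congr 1
    have hb : b = 1 - a := by linarith
    rw [hb]; ring
  rw [e1, e2]
  ring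

theorem stmt1 (n : ℕ) (hn : 2 ≤ n) (p : ℝ) (hp0 : 0 < p) (hpn : p < n)
    (a b : ℝ) (ha : a = 2 / (n + p)) (hb : b = (n + p - 2) / (n + p))
    (xn : EuclideanSpace ℝ (Fin n) → ℝ) (hxn : ∀ x, xn x = x ⟨n - 1, by omega⟩)
    (s : EuclideanSpace ℝ (Fin n) → ℝ) (hs : ∀ x, s x = ‖x‖ ^ 2 - (xn x) ^ 2)
    (Ω : Set (EuclideanSpace ℝ (Fin n)))
    (hΩ : Ω = {x | s x < 1 ∧ 0 < xn x ∧ xn x < 1 - s x})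
    (w : EuclideanSpace ℝ (Fin n) → ℝ)
    (hw : ∀ x, w x = xn x - (xn x) ^ a * (1 - s x) ^ b) :
    MeasureTheory.IntegrableOn (fun x => hessDet w x) Ω := by
  obtain ⟨m, rfl⟩ : ∃ m, n = m + 1 := ⟨n - 1, by omega⟩
  have hpos : (0:ℝ) < ((m + 1 : ℕ) : ℝ) + p := by positivity
  have hab : a + b = 1 := by rw [ha, hb]; field_simp; ring
  have hr : -1 < ((m + 1 : ℕ) : ℝ) * a - 2 := by
    have : 1 < ((m + 1 : ℕ) : ℝ) * a := by
      rw [ha, ← mul_div_assoc, lt_div_iff₀ hpos]; linarith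
    linarith
  simp only [hs, hxn] at hw hΩ
  set i0 : Fin (m+1) := ⟨m + 1 - 1, by omega⟩
  have hm : MeasurableSet Ω := by
    rw [hΩ]
    have a1 : MeasurableSet {z : EuclideanSpace ℝ (Fin (m+1)) | ‖z‖ ^ 2 - z i0 ^ 2 < 1} :=
      measurableSet_lt (by fun_prop) (by fun_prop)
    have a2 : MeasurableSet {z : EuclideanSpace ℝ (Fin (m+1)) | 0 < z i0} :=
      measurableSet_lt (by fun_prop) (by fun_prop)
    have a3 : MeasurableSet {z : EuclideanSpace ℝ (Fin (m+1)) | z i0 < 1 - (‖z‖ ^ 2 - z i0 ^ 2)} :=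
      measurableSet_lt (by fun_prop) (by fun_prop)
    exact a1.inter (a2.inter a3)
  have h := (aux_euc m _ hr i0).const_mul (a * b * (2 * b) ^ (m + 1 - 1))
  rw [← hΩ] at h
  refine MeasureTheory.IntegrableOn.congr_fun h (fun x hx => ?_) hm
  rw [hΩ] at hx
  exact (aux_hess i0 a b hab w hw x hx.2.1 (by linarith [hx.1])).symm
end

section
/- Let p > 0, a = 2/(n+p), b = n/(n+p), and Ω₁ = {(x', x_n) : |x'| < 1, 0 < x_n < (1-|x'|²)^{n/(n+p-2)}} ⊂ ℝⁿ (n ≥ 2). Then the function w(x', x_n) = [x_n - x_n^a (1-|x'|²)^b]/2 is smooth on Ω₁, negative on Ω₁, vanishes on ∂Ω₁, and satisfies det D²w ≤ |w|^{-p} pointwise in Ω₁. -/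
open Real

theorem det_aux {n : ℕ} (α β γ δ R : ℝ) (hα : α ≠ 0) (u e : Fin n → ℝ)
    (huu : ∑ i, u i * u i = R) (hue : ∑ i, u i * e i = 0) (hee : ∑ i, e i * e i = 1) :
    (Matrix.of fun i j : Fin n => α * (if i = j then 1 else 0) + β * u i * u j
      + γ * (u i * e j + e i * u j) + δ * e i * e j).det
      = α ^ n / α ^ 2 * ((α + β * R) * (α + δ) - γ ^ 2 * R) := by
  have heu : ∑ i, e i * u i = 0 := by simpa only [mul_comm] using hue
  let U : Matrix (Fin n) (Fin 2) ℝ := Matrix.of fun i k => ![u i, e i] k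
  let V : Matrix (Fin 2) (Fin n) ℝ := Matrix.of fun k j =>
    ![(β * u j + γ * e j) / α, (γ * u j + δ * e j) / α] k
  have h1 : (Matrix.of fun i j : Fin n => α * (if i = j then 1 else 0) + β * u i * u j
      + γ * (u i * e j + e i * u j) + δ * e i * e j) = α • (1 + U * V) := by
    ext i j
    simp [U, V, Matrix.mul_apply, Fin.sum_univ_two, Matrix.one_apply]
    split_ifs <;> field_simp <;> ring
  have h2 : V * U = !![β * R / α, γ / α; γ * R / α, δ / α] := by
    ext i j
    fin_cases i <;> fin_cases j <;>
      simp [U, V, Matrix.mul_apply, add_mul, div_mul_eq_mul_div, ← Finset.sum_div, Finset.sum_add_distrib,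
        mul_assoc, ← Finset.mul_sum, huu, hue, heu, hee]
  rw [h1, Matrix.det_smul, Matrix.det_one_add_mul_comm, h2, Matrix.det_fin_two]
  simp
  field_simp

set_option maxHeartbeats 1000000 in
theorem hasF {n : ℕ} (k : Fin n) (c d : ℝ) (x : EuclideanSpace ℝ (Fin n))
    (hy : 0 < x k) (ht : 0 < 1 - (‖x‖ ^ 2 - x k ^ 2)) :
    ∃ L : EuclideanSpace ℝ (Fin n) →L[ℝ] ℝ,
      HasFDerivAt (fun x : EuclideanSpace ℝ (Fin n) =>
        (x k) ^ c * (1 - (‖x‖ ^ 2 - x k ^ 2)) ^ d) L x ∧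
      ∀ j, L (EuclideanSpace.single j 1) =
        c * (x k) ^ (c - 1) * (1 - (‖x‖ ^ 2 - x k ^ 2)) ^ d * (if j = k then 1 else 0)
        - 2 * d * (x k) ^ c * (1 - (‖x‖ ^ 2 - x k ^ 2)) ^ (d - 1)
          * (x j - x k * (if j = k then 1 else 0)) := by
  have h1 : HasFDerivAt (fun x : EuclideanSpace ℝ (Fin n) => x k)
    (EuclideanSpace.proj k : EuclideanSpace ℝ (Fin n) →L[ℝ] ℝ) x :=
    (EuclideanSpace.proj k : EuclideanSpace ℝ (Fin n) →L[ℝ] ℝ).hasFDerivAt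
  have h2 : HasFDerivAt (fun x : EuclideanSpace ℝ (Fin n) => ‖x‖ ^ 2) (2 • innerSL ℝ x) x :=
    (hasStrictFDerivAt_norm_sq x).hasFDerivAt
  have h3 := (h2.sub (h1.pow 2)).const_sub 1
  have h4 := (h1.rpow_const (p := c) (Or.inl hy.ne')).mul
    (h3.rpow_const (p := d) (Or.inl ht.ne'))
  refine ⟨_, h4, fun j => ?_⟩
  have e1 : (EuclideanSpace.single j (1:ℝ)) k = if j = k then 1 else 0 := by
    simp [Pi.single_apply, eq_comm]
  simp [real_inner_comm, EuclideanSpace.inner_single_left, EuclideanSpace.inner_single_right,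
    e1, Pi.single_apply, eq_comm]
  split_ifs <;> ring

theorem hess_aux {n : ℕ} (k : Fin n) (a b : ℝ) (x : EuclideanSpace ℝ (Fin n))
    (hy : 0 < x k) (ht : 0 < 1 - (‖x‖ ^ 2 - x k ^ 2)) (i j : Fin n) :
    fderiv ℝ (fun y => fderiv ℝ (fun x : EuclideanSpace ℝ (Fin n) =>
        (x k - (x k) ^ a * (1 - (‖x‖ ^ 2 - x k ^ 2)) ^ b) / 2) y (EuclideanSpace.single i 1)) x
      (EuclideanSpace.single j 1) =
    (let Y := (x k) ^ a; let t := 1 - (‖x‖ ^ 2 - x k ^ 2); let T := t ^ b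
     let e : Fin n → ℝ := fun i => if i = k then 1 else 0
     let u : Fin n → ℝ := fun i => x i - x k * e i
     (b * Y * T / t) * (if i = j then 1 else 0) + (2 * (1 - b) * b * Y * T / t ^ 2) * u i * u j
      + (a * b * Y * T / (x k * t)) * (u i * e j + e i * u j)
      + (a * (1 - a) / 2 * Y * T / (x k) ^ 2 - b * Y * T / t) * e i * e j) := by
  have hop : ∀ᶠ z : EuclideanSpace ℝ (Fin n) in nhds x,
      0 < z k ∧ 0 < 1 - (‖z‖ ^ 2 - z k ^ 2) := by
    have c1 : Continuous fun z : EuclideanSpace ℝ (Fin n) => z k := by fun_prop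
    have c2 : Continuous fun z : EuclideanSpace ℝ (Fin n) => 1 - (‖z‖ ^ 2 - z k ^ 2) := by
      fun_prop
    exact (c1.continuousAt.eventually (lt_mem_nhds hy)).and
      (c2.continuousAt.eventually (lt_mem_nhds ht))
  have hproj : ∀ (l : Fin n) (z : EuclideanSpace ℝ (Fin n)),
      HasFDerivAt (fun x : EuclideanSpace ℝ (Fin n) => x l)
      (EuclideanSpace.proj l : EuclideanSpace ℝ (Fin n) →L[ℝ] ℝ) z := fun l z =>
    (EuclideanSpace.proj l : EuclideanSpace ℝ (Fin n) →L[ℝ] ℝ).hasFDerivAt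
  have hev : (fun y => fderiv ℝ (fun x : EuclideanSpace ℝ (Fin n) =>
        (x k - (x k) ^ a * (1 - (‖x‖ ^ 2 - x k ^ 2)) ^ b) / 2) y (EuclideanSpace.single i 1))
      =ᶠ[nhds x] fun z => ((if i = k then 1 else 0) -
        (a * (if i = k then 1 else 0) * (z k ^ (a - 1) * (1 - (‖z‖ ^ 2 - z k ^ 2)) ^ b)
        - 2 * b * ((z k ^ a * (1 - (‖z‖ ^ 2 - z k ^ 2)) ^ (b - 1))
          * (z i - z k * (if i = k then 1 else 0))))) * (1 / 2) := by
    filter_upwards [hop] with z hz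
    obtain ⟨L, hL, hLj⟩ := hasF k a b z hz.1 hz.2
    have := ((hproj k z).sub hL).mul_const (2⁻¹ : ℝ)
    simp only [div_eq_mul_inv]
    refine (congrArg (fun M : EuclideanSpace ℝ (Fin n) →L[ℝ] ℝ =>
      M (EuclideanSpace.single i 1)) this.fderiv).trans ?_
    simp only [smul_apply, sub_apply, hLj,
      PiLp.proj_apply, PiLp.single_apply, smul_eq_mul, @eq_comm _ k i]
    ring
  rw [hev.fderiv_eq]
  obtain ⟨L1, hL1, hL1j⟩ := hasF k (a - 1) b x hy ht
  obtain ⟨L2, hL2, hL2j⟩ := hasF k a (b - 1) x hy ht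
  have := (((hL1.const_mul (a * (if i = k then 1 else 0))).sub ((hL2.mul ((hproj i x).sub
    ((hproj k x).mul_const (if i = k then 1 else 0)))).const_mul (2 * b))).const_sub
      (if i = k then 1 else 0)).mul_const (1 / 2 : ℝ)
  have h' := this.fderiv
  refine (congrArg (fun M : EuclideanSpace ℝ (Fin n) →L[ℝ] ℝ =>
    M (EuclideanSpace.single j 1)) h').trans ?_
  simp only [smul_apply, sub_apply,
    add_apply, neg_apply, hL1j, hL2j,
    PiLp.proj_apply, PiLp.single_apply, smul_eq_mul, @eq_comm _ k j]
  simp only [Pi.sub_apply]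
  rw [Real.rpow_sub_one hy.ne' (a - 1), Real.rpow_sub_one ht.ne' (b - 1),
    Real.rpow_sub_one hy.ne' a, Real.rpow_sub_one ht.ne' b]
  generalize hY : x k ^ a = Y
  generalize hT : (1 - (‖x‖ ^ 2 - x k ^ 2)) ^ b = T
  generalize (1 - (‖x‖ ^ 2 - x k ^ 2)) = t at *
  have h5 := hy.ne'
  have h6 := ht.ne'
  generalize (if i = j then (1:ℝ) else 0) = D
  generalize (if i = k then (1:ℝ) else 0) = Ei
  generalize (if j = k then (1:ℝ) else 0) = Ej
  generalize x k = y at *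
  generalize x i = z at *
  generalize x j = q at *
  clear * - h5 h6
  field_simp
  ring

theorem stmt4 (n : ℕ) (hn : 2 ≤ n) (p : ℝ) (hp : 0 < p)
    (a b : ℝ) (ha : a = 2 / (n + p)) (hb : b = n / (n + p))
    (xn : EuclideanSpace ℝ (Fin n) → ℝ) (hxn : ∀ x, xn x = x ⟨n - 1, by omega⟩)
    (s : EuclideanSpace ℝ (Fin n) → ℝ) (hs : ∀ x, s x = ‖x‖ ^ 2 - (xn x) ^ 2)
    (Ω₁ : Set (EuclideanSpace ℝ (Fin n)))
    (hΩ₁ : Ω₁ = {x | s x < 1 ∧ 0 < xn x ∧ xn x < (1 - s x) ^ ((n : ℝ) / (n + p - 2))})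
    (w : EuclideanSpace ℝ (Fin n) → ℝ)
    (hw : ∀ x, w x = (xn x - (xn x) ^ a * (1 - s x) ^ b) / 2) :
    ContDiffOn ℝ (⊤ : ℕ∞) w Ω₁ ∧ (∀ x ∈ Ω₁, w x < 0) ∧ (∀ x ∈ frontier Ω₁, w x = 0) ∧
      ∀ x ∈ Ω₁, hessDet w x ≤ |w x| ^ (-p) := by
  have hn' : (2:ℝ) ≤ n := by exact_mod_cast hn
  have hnp : 0 < (n:ℝ) + p := by linarith
  have hnp2 : 0 < (n:ℝ) + p - 2 := by linarith
  have ha0 : 0 < a := by rw [ha]; positivity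
  have hb0 : 0 < b := by rw [hb]; positivity
  have ha1 : a < 1 := by rw [ha, div_lt_one hnp]; linarith
  have hb1 : b < 1 := by rw [hb, div_lt_one hnp]; linarith
  have hc0 : 0 < (n:ℝ) / (n + p - 2) := by positivity
  have hcb : (n:ℝ) / (n + p - 2) * (1 - a) = b := by
    rw [ha, hb]; field_simp
  generalize hc : (n:ℝ) / (n + p - 2) = c at *
  generalize hk : (⟨n - 1, by omega⟩ : Fin n) = k at *
  obtain rfl : xn = fun x => x k := funext hxn
  obtain rfl : s = fun x => ‖x‖ ^ 2 - x k ^ 2 := funext hs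
  obtain rfl := funext hw
  clear hw hs hxn
  subst hΩ₁
  -- scalar comparison
  have hlt : ∀ y t : ℝ, 0 < y → 0 < t → y < t ^ c → y < y ^ a * t ^ b := by
    intro y t hy ht h
    have h1 : y ^ (1 - a) < t ^ b := by
      rw [← hcb, Real.rpow_mul ht.le]
      exact Real.rpow_lt_rpow hy.le h (by linarith)
    calc y = y ^ a * y ^ (1 - a) := by
          rw [← Real.rpow_add hy]; simp
      _ < _ := by
          have := Real.rpow_pos_of_pos hy a
          gcongr
  have hsq : ∀ x : EuclideanSpace ℝ (Fin n),
      ∑ i, (x i - x k * (if i = k then 1 else 0)) * (x i - x k * (if i = k then 1 else 0))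
        = ‖x‖ ^ 2 - x k ^ 2 := by
    intro x
    rw [EuclideanSpace.real_norm_sq_eq]
    have : ∀ i, (x i - x k * (if i = k then 1 else 0)) * (x i - x k * (if i = k then 1 else 0))
        = x i ^ 2 - (if i = k then x k ^ 2 else 0) := by
      intro i
      split_ifs with h
      · subst h; ring
      · ring
    simp only [this, Finset.sum_sub_distrib]
    simp
  have c1 : Continuous fun z : EuclideanSpace ℝ (Fin n) => z k := by fun_prop
  have c2 : Continuous fun z : EuclideanSpace ℝ (Fin n) => ‖z‖ ^ 2 - z k ^ 2 := by
    fun_prop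
  have c3 : Continuous fun z : EuclideanSpace ℝ (Fin n) =>
      (1 - (‖z‖ ^ 2 - z k ^ 2)) ^ c :=
    (continuous_const.sub c2).rpow_const fun _ => Or.inr hc0.le
  have hneg : ∀ x ∈ {x : EuclideanSpace ℝ (Fin n) | ‖x‖ ^ 2 - x k ^ 2 < 1 ∧ 0 < x k ∧
      x k < (1 - (‖x‖ ^ 2 - x k ^ 2)) ^ c},
      (x k - x k ^ a * (1 - (‖x‖ ^ 2 - x k ^ 2)) ^ b) / 2 < 0 := by
    rintro x ⟨h1, h2, h3⟩
    have := hlt _ _ h2 (by linarith) h3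
    linarith
  refine ⟨?_, hneg, ?_, ?_⟩
  · rintro x ⟨h1, h2, h3⟩
    refine ContDiffAt.contDiffWithinAt ?_
    have d1 : ContDiffAt ℝ (⊤ : ℕ∞) (fun z : EuclideanSpace ℝ (Fin n) => z k) x := by fun_prop
    have d2 : ContDiffAt ℝ (⊤ : ℕ∞)
        (fun z : EuclideanSpace ℝ (Fin n) => 1 - (‖z‖ ^ 2 - z k ^ 2)) x :=
      contDiffAt_const.sub ((contDiff_norm_sq ℝ).contDiffAt.sub (d1.pow 2))
    have h1' : 1 - (‖x‖ ^ 2 - x k ^ 2) ≠ 0 := by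
      simp only at h1
      linarith
    exact (d1.sub ((d1.rpow_const_of_ne h2.ne').mul (d2.rpow_const_of_ne h1'))).div_const 2
  · intro x hx
    have hopen : IsOpen {x : EuclideanSpace ℝ (Fin n) | ‖x‖ ^ 2 - x k ^ 2 < 1 ∧ 0 < x k ∧
      x k < (1 - (‖x‖ ^ 2 - x k ^ 2)) ^ c} :=
      (isOpen_lt c2 continuous_const).inter
        ((isOpen_lt continuous_const c1).inter (isOpen_lt c1 c3))
    have hcl : closure {x : EuclideanSpace ℝ (Fin n) | ‖x‖ ^ 2 - x k ^ 2 < 1 ∧ 0 < x k ∧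
      x k < (1 - (‖x‖ ^ 2 - x k ^ 2)) ^ c} ⊆ {x | ‖x‖ ^ 2 - x k ^ 2 ≤ 1 ∧ 0 ≤ x k ∧
      x k ≤ (1 - (‖x‖ ^ 2 - x k ^ 2)) ^ c} := by
      refine closure_minimal (fun z hz => ⟨hz.1.le, hz.2.1.le, hz.2.2.le⟩) ?_
      exact (isClosed_le c2 continuous_const).inter
        ((isClosed_le continuous_const c1).inter (isClosed_le c1 c3))
    rw [hopen.frontier_eq] at hx
    obtain ⟨h1, h2, h3⟩ := hcl hx.1
    have hx2 : ¬ (‖x‖ ^ 2 - x k ^ 2 < 1 ∧ 0 < x k ∧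
      x k < (1 - (‖x‖ ^ 2 - x k ^ 2)) ^ c) := hx.2
    simp only
    rcases h2.eq_or_lt with h | h
    · rw [← h, Real.zero_rpow ha0.ne']; simp
    rcases h1.eq_or_lt with h' | h'
    · rw [h'] at h3
      simp [Real.zero_rpow hc0.ne'] at h3
      linarith
    rcases h3.eq_or_lt with h'' | h''
    · have ht : 0 ≤ 1 - (‖x‖ ^ 2 - x k ^ 2) := by linarith
      have : (1 - (‖x‖ ^ 2 - x k ^ 2)) ^ b = x k ^ (1 - a) := by
        rw [← hcb, Real.rpow_mul ht, ← h'']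
      rw [this, ← Real.rpow_add h]
      simp
    · exact absurd ⟨h', h, h''⟩ hx2
  · intro x hx
    have hw0 := hneg x hx
    obtain ⟨h1, h2, h3⟩ := hx
    replace h2 : 0 < x k := h2
    have ht : 0 < 1 - (‖x‖ ^ 2 - x k ^ 2) := by
      simp only at h1
      linarith
    have hs0 : 0 ≤ ‖x‖ ^ 2 - x k ^ 2 := by
      rw [← hsq]
      exact Finset.sum_nonneg fun i _ => mul_self_nonneg _
    unfold hessDet
    simp only [hess_aux k a b x h2 ht]
    have hY := Real.rpow_pos_of_pos h2 a
    have hT := Real.rpow_pos_of_pos ht b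
    rw [det_aux _ _ _ _ (‖x‖ ^ 2 - x k ^ 2) (by positivity) _ _ (hsq x) (by simp) (by simp)]
    have key : (x k ^ a * (1 - (‖x‖ ^ 2 - x k ^ 2)) ^ b) ^ (-p) =
        (x k ^ a * (1 - (‖x‖ ^ 2 - x k ^ 2)) ^ b) ^ n
          / ((1 - (‖x‖ ^ 2 - x k ^ 2)) ^ n * x k ^ 2) := by
      have e1 : (x k ^ a * (1 - (‖x‖ ^ 2 - x k ^ 2)) ^ b) ^ ((n:ℝ) + p) =
          (1 - (‖x‖ ^ 2 - x k ^ 2)) ^ n * x k ^ 2 := by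
        rw [Real.mul_rpow hY.le hT.le, ← Real.rpow_mul h2.le, ← Real.rpow_mul ht.le]
        rw [show a * (n + p) = (2:ℕ) by rw [ha]; push_cast; field_simp,
          show b * (n + p) = (n:ℕ) by rw [hb]; field_simp,
          Real.rpow_natCast, Real.rpow_natCast, mul_comm]
      rw [← e1, ← Real.rpow_natCast _ n, ← Real.rpow_sub (mul_pos hY hT)]
      congr 1; ring
    have hle : (x k ^ a * (1 - (‖x‖ ^ 2 - x k ^ 2)) ^ b) ^ (-p) ≤
        |(x k - x k ^ a * (1 - (‖x‖ ^ 2 - x k ^ 2)) ^ b) / 2| ^ (-p) := by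
      apply Real.rpow_le_rpow_of_nonpos (abs_pos.2 hw0.ne) _ (by linarith)
      rw [abs_of_neg hw0]
      nlinarith [mul_pos hY hT]
    refine le_trans ?_ hle
    rw [key]
    generalize x k ^ a = Y at *
    generalize (1 - (‖x‖ ^ 2 - x k ^ 2)) ^ b = T at *
    generalize hS : ‖x‖ ^ 2 - x k ^ 2 = S at *
    generalize x k = y at *
    clear * - hb0 hb1 ha0 ha1 hY hT hs0 ht h2 hn
    have hbn : b ^ n ≤ b := by
      simpa using pow_le_pow_of_le_one hb0.le hb1.le (show 1 ≤ n by omega)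
    have hbn0 : 0 < b ^ n := by positivity
    obtain ⟨t, rfl⟩ : ∃ t, S = 1 - t := ⟨1 - S, by ring⟩
    simp only [sub_sub_cancel] at ht ⊢
    have hK : a / 2 * ((1 - a) + (1 - t) * (1 - a - 2 * b)) ≤ 1 := by
      have : (1 - a) + (1 - t) * (1 - a - 2 * b) ≤ 2 := by nlinarith
      nlinarith
    have hQ : 0 < (Y * T) ^ n / (t ^ n * y ^ 2) := by positivity
    calc _ = b ^ n / b * (a / 2 * ((1 - a) + (1 - t) * (1 - a - 2 * b))) *
          ((Y * T) ^ n / (t ^ n * y ^ 2)) := by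
          rw [div_pow (b * Y * T), mul_pow (b * Y) T, mul_pow b Y, mul_pow Y T]
          field_simp
          ring
      _ ≤ 1 * ((Y * T) ^ n / (t ^ n * y ^ 2)) := by
          refine mul_le_mul_of_nonneg_right ?_ hQ.le
          have h3 : b ^ n / b ≤ 1 := (div_le_one hb0).2 hbn
          have h4 : 0 < b ^ n / b := by positivity
          nlinarith
      _ = _ := one_mul _
end

section
/- Let T ⊂ ℝ² be the triangle with vertices (0,0), (1,0), (0,1), and define σ_T(x₁, x₂) = -(1/π²)[𝓛(πx₁) + 𝓛(πx₂) + 𝓛(π(1 - x₁ - x₂))], where 𝓛(θ) = -∫₀^θ log|2 sin u| du is the Lobachevsky function. Then σ_T is smooth in the interior of T and det D²σ_T = 1 there. -/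
open Real

lemma L_hasDeriv (L : ℝ → ℝ)
    (hL : ∀ θ, L θ = -∫ u in (0 : ℝ)..θ, Real.log |2 * Real.sin u|)
    (t : ℝ) (h0 : 0 < t) (h1 : t < π) :
    HasDerivAt L (-Real.log (2 * Real.sin t)) t := by
  have hs : 0 < Real.sin t := Real.sin_pos_of_pos_of_lt_pi h0 h1
  have e : L = fun θ => -∫ u in (0 : ℝ)..θ, Real.log (2 * Real.sin u) := by
    funext θ
    simp only [hL, Real.log_abs]
  rw [e]
  have hint : IntervalIntegrable (fun u => Real.log (2 * Real.sin u))
      MeasureTheory.volume 0 t := by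
    have : IntervalIntegrable (fun u => Real.log ‖2 * Real.sin u‖)
        MeasureTheory.volume 0 t := by
      apply MeromorphicOn.intervalIntegrable_log_norm
      intro x _
      exact AnalyticAt.meromorphicAt (by fun_prop)
    simpa only [Real.norm_eq_abs, Real.log_abs] using this
  refine (intervalIntegral.integral_hasDerivAt_right hint ?_ ?_).neg
  · exact MeasureTheory.StronglyMeasurable.stronglyMeasurableAtFilter (by fun_prop : Measurable _).stronglyMeasurable
  · exact ContinuousAt.log (by fun_prop) (by positivity)

lemma L_contDiffOn (L : ℝ → ℝ)
    (hL : ∀ θ, L θ = -∫ u in (0 : ℝ)..θ, Real.log |2 * Real.sin u|) :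
    ContDiffOn ℝ (⊤ : ℕ∞) L (Set.Ioo 0 π) := by
  rw [contDiffOn_infty_iff_deriv_of_isOpen isOpen_Ioo]
  refine ⟨fun t ht => (L_hasDeriv L hL t ht.1 ht.2).differentiableAt.differentiableWithinAt, ?_⟩
  have : ContDiffOn ℝ (⊤ : ℕ∞) (fun t => -Real.log (2 * Real.sin t)) (Set.Ioo 0 π) := by
    refine (ContDiffOn.log ?_ ?_).neg
    · exact (contDiff_const.mul Real.contDiff_sin).contDiffOn
    · intro t ht
      have hs : 0 < Real.sin t := Real.sin_pos_of_pos_of_lt_pi ht.1 ht.2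
      positivity
  exact this.congr fun t ht => (L_hasDeriv L hL t ht.1 ht.2).deriv

noncomputable abbrev pr (i : Fin 2) : EuclideanSpace ℝ (Fin 2) →L[ℝ] ℝ := EuclideanSpace.proj i

lemma pr_has (i : Fin 2) (x : EuclideanSpace ℝ (Fin 2)) :
    HasFDerivAt (fun y : EuclideanSpace ℝ (Fin 2) => y i) (pr i) x :=
  (pr i).hasFDerivAt

lemma logsin_has (t : ℝ) (h0 : 0 < t) (h1 : t < π) :
    HasDerivAt (fun t => Real.log (2 * Real.sin t)) (Real.cos t / Real.sin t) t := by
  have hs : 0 < Real.sin t := Real.sin_pos_of_pos_of_lt_pi h0 h1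
  have := ((Real.hasDerivAt_sin t).const_mul 2).log (by positivity)
  convert this using 1
  field_simp

lemma third_has (x : EuclideanSpace ℝ (Fin 2)) :
    HasFDerivAt (fun y : EuclideanSpace ℝ (Fin 2) => π * (1 - y 0 - y 1))
      (π • (-pr 0 - pr 1)) x := by
  have := (((pr_has 0 x).const_sub 1).sub (pr_has 1 x)).const_mul π
  exact this

theorem stmt12 (L : ℝ → ℝ) (hL : ∀ θ, L θ = -∫ u in (0 : ℝ)..θ, Real.log |2 * Real.sin u|)
    (σT : EuclideanSpace ℝ (Fin 2) → ℝ)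
    (hσ : ∀ x, σT x = -(1 / π ^ 2) *
      (L (π * x 0) + L (π * x 1) + L (π * (1 - x 0 - x 1))))
    (Tint : Set (EuclideanSpace ℝ (Fin 2)))
    (hT : Tint = {x | 0 < x 0 ∧ 0 < x 1 ∧ x 0 + x 1 < 1}) :
    ContDiffOn ℝ (⊤ : ℕ∞) σT Tint ∧ ∀ x ∈ Tint, hessDet σT x = 1 := by
  have hpi := Real.pi_pos
  obtain rfl : σT = _ := funext hσ
  have b0 : ∀ x ∈ Tint, 0 < π * x 0 ∧ π * x 0 < π := by
    intro x hx
    rw [hT] at hx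
    obtain ⟨h1, h2, h3⟩ := hx
    constructor <;> nlinarith
  have b1 : ∀ x ∈ Tint, 0 < π * x 1 ∧ π * x 1 < π := by
    intro x hx
    rw [hT] at hx
    obtain ⟨h1, h2, h3⟩ := hx
    constructor <;> nlinarith
  have b2 : ∀ x ∈ Tint, 0 < π * (1 - x 0 - x 1) ∧ π * (1 - x 0 - x 1) < π := by
    intro x hx
    rw [hT] at hx
    obtain ⟨h1, h2, h3⟩ := hx
    constructor <;> nlinarith
  have hopen : IsOpen Tint := by
    rw [hT]
    have c0 : Continuous (fun y : EuclideanSpace ℝ (Fin 2) => y 0) := (pr 0).continuous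
    have c1 : Continuous (fun y : EuclideanSpace ℝ (Fin 2) => y 1) := (pr 1).continuous
    exact (isOpen_lt continuous_const c0).inter
      ((isOpen_lt continuous_const c1).inter (isOpen_lt (c0.add c1) continuous_const))
  have hLc := L_contDiffOn L hL
  constructor
  · refine contDiffOn_const.mul (((hLc.comp ?_ b0).add (hLc.comp ?_ b1)).add (hLc.comp ?_ b2))
    all_goals exact ContDiff.contDiffOn (by fun_prop)
  intro x hx
  have hF : ∀ y ∈ Tint, HasFDerivAt (fun x : EuclideanSpace ℝ (Fin 2) => -(1 / π ^ 2) *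
      (L (π * x 0) + L (π * x 1) + L (π * (1 - x 0 - x 1))))
      ((-(1 / π ^ 2)) • ((-Real.log (2 * Real.sin (π * y 0))) • (π • pr 0) +
        (-Real.log (2 * Real.sin (π * y 1))) • (π • pr 1) +
        (-Real.log (2 * Real.sin (π * (1 - y 0 - y 1)))) • (π • (-pr 0 - pr 1)))) y := by
    intro y hy
    have d0 := (L_hasDeriv L hL _ (b0 y hy).1 (b0 y hy).2).comp_hasFDerivAt y
      ((pr_has 0 y).const_mul π)
    have d1 := (L_hasDeriv L hL _ (b1 y hy).1 (b1 y hy).2).comp_hasFDerivAt y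
      ((pr_has 1 y).const_mul π)
    have d2 := (L_hasDeriv L hL _ (b2 y hy).1 (b2 y hy).2).comp_hasFDerivAt y (third_has y)
    exact ((d0.add d1).add d2).const_mul _
  have g0 := (logsin_has _ (b0 x hx).1 (b0 x hx).2).comp_hasFDerivAt x
    ((pr_has 0 x).const_mul π)
  have g1 := (logsin_has _ (b1 x hx).1 (b1 x hx).2).comp_hasFDerivAt x
    ((pr_has 1 x).const_mul π)
  have g2 := (logsin_has _ (b2 x hx).1 (b2 x hx).2).comp_hasFDerivAt x (third_has x)
  have e0 : (fun y => fderiv ℝ (fun x : EuclideanSpace ℝ (Fin 2) => -(1 / π ^ 2) *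
      (L (π * x 0) + L (π * x 1) + L (π * (1 - x 0 - x 1)))) y (EuclideanSpace.single 0 1))
      =ᶠ[nhds x] fun y => (1 / π) * (Real.log (2 * Real.sin (π * y 0)) -
        Real.log (2 * Real.sin (π * (1 - y 0 - y 1)))) := by
    filter_upwards [hopen.mem_nhds hx] with y hy
    rw [(hF y hy).fderiv]
    simp [pr]
    field_simp
    ring
  have e1 : (fun y => fderiv ℝ (fun x : EuclideanSpace ℝ (Fin 2) => -(1 / π ^ 2) *
      (L (π * x 0) + L (π * x 1) + L (π * (1 - x 0 - x 1)))) y (EuclideanSpace.single 1 1))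
      =ᶠ[nhds x] fun y => (1 / π) * (Real.log (2 * Real.sin (π * y 1)) -
        Real.log (2 * Real.sin (π * (1 - y 0 - y 1)))) := by
    filter_upwards [hopen.mem_nhds hx] with y hy
    rw [(hF y hy).fderiv]
    simp [pr]
    field_simp
    ring
  have f0 := (((g0.sub g2).const_mul (1 / π)).congr_of_eventuallyEq e0).fderiv
  have f1 := (((g1.sub g2).const_mul (1 / π)).congr_of_eventuallyEq e1).fderiv
  unfold hessDet
  rw [Matrix.det_fin_two]
  simp only [Matrix.of_apply]
  rw [f0, f1]
  have s0 := Real.sin_pos_of_pos_of_lt_pi (b0 x hx).1 (b0 x hx).2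
  have s1 := Real.sin_pos_of_pos_of_lt_pi (b1 x hx).1 (b1 x hx).2
  have s2 := Real.sin_pos_of_pos_of_lt_pi (b2 x hx).1 (b2 x hx).2
  have hs : Real.sin (π * (1 - x 0 - x 1)) = Real.sin (π * x 0 + π * x 1) := by
    rw [← Real.sin_pi_sub]; congr 1; ring
  have hc : Real.cos (π * (1 - x 0 - x 1)) = -Real.cos (π * x 0 + π * x 1) := by
    rw [← Real.cos_pi_sub]; congr 1; ring
  rw [hs, Real.sin_add] at s2
  simp [pr]
  rw [hs, hc, Real.sin_add, Real.cos_add]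
  generalize Real.sin (π * x 0) = a at *
  generalize Real.sin (π * x 1) = b at *
  generalize Real.cos (π * x 0) = c at *
  generalize Real.cos (π * x 1) = d at *
  have := s2.ne'
  field_simp
  ring
end
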